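/- Let Q₀ > 1, s > 0, and q∞ ∈ (Q₀^{−1}, Q₀), and suppose the speed c = c(q∞, ε) satisfies 0 < c ≤ mQ₀ for all small ε. Set Ψ̊_ε(x) = Γ((x − q∞e₂)/ε) − Γ((x + q∞e₂)/ε) and Ω = m + (m·log(2q∞) − c·q∞)/|log ε|. Then there exist ε₀ > 0 and C > 0 such that for all 0 < ε ≤ ε₀: (i) the support of f_ε(Ψ̊_ε − c x₂) is contained in B_{ρ₀ε}(q∞e₂) ∪ B_{ρ₀ε}(−q∞e₂), where ρ₀ = 2(1 + sQ₀/2)·e^{Q₀²}; and (ii) with q' = q∞/ε, for all y ∈ ℝ², |(Γ(y − q'e₂))₊^γ − (Γ(y − q'e₂) − Γ(y + q'e₂) − cε y₂ − |log ε|·Ω)₊^γ · 1_{B_{s/ε}(q'e₂)}(y)| ≤ Cε · 1_{B_{ρ₀}(q'e₂)}(y), with the analogous statement around −q'e₂ by odd symmetry in y₂. -/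

import Mathlib

open MeasureTheory Metric Real Filter Topology Set
open scoped ENNReal

noncomputable section

/-- The plane `ℝ²`. -/
abbrev E2 : Type := EuclideanSpace ℝ (Fin 2)

/-- First standard basis vector. -/
def e1 : E2 := EuclideanSpace.single 0 1

/-- Second standard basis vector. -/
def e2 : E2 := EuclideanSpace.single 1 1

/-- Partial derivative in direction `i`. -/
def pdv (i : Fin 2) (f : E2 → ℝ) (x : E2) : ℝ := fderiv ℝ f x (EuclideanSpace.single i 1)

/-- The Laplacian `Δf = ∂₁₁ f + ∂₂₂ f`. -/
def lap (f : E2 → ℝ) (x : E2) : ℝ := pdv 0 (pdv 0 f) x + pdv 1 (pdv 1 f) x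

/-- The cut-off power nonlinearity
`f_ε(Ψ − c x₂)(x) = (Ψ(x) − c x₂ − |log ε|Ω)₊^γ 1_{B_s(q e₂)}(x)
  − (−Ψ(x) + c x₂ − |log ε|Ω)₊^γ 1_{B_s(−q e₂)}(x)`. -/
def fcut (γ ε s q c Ω : ℝ) (Ψ : E2 → ℝ) (x : E2) : ℝ :=
  Set.indicator (ball ((q • e2 : E2)) s)
    (fun y => (max (Ψ y - c * y 1 - |Real.log ε| * Ω) 0) ^ γ) x
  - Set.indicator (ball ((-(q • e2) : E2)) s)
    (fun y => (max (-Ψ y + c * y 1 - |Real.log ε| * Ω) 0) ^ γ) x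

/-- The argument of the cut-off nonlinearity near the upper vortex, in the rescaled coordinate
`z` centred at that vortex; `q` is the height of the vortex and `k` the travelling speed. -/
def vortexStream (Γ : E2 → ℝ) (m q k ε : ℝ) (z : E2) : ℝ :=
  Γ z - Γ (z + (2 * q / ε) • e2) - k * ε * z 1 - m * Real.log (2 * q / ε)

lemma norm_e2 : ‖e2‖ = 1 := by simp [e2]

lemma abs_apply_le_norm (z : E2) (i : Fin 2) : |z i| ≤ ‖z‖ := by
  simpa using PiLp.norm_apply_le z i

lemma abs_max_rpow_sub_le {γ M a b : ℝ} (hγ : 1 ≤ γ) (hM : 0 ≤ M) (ha : a ≤ M) (hb : b ≤ M) :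
    |(max a 0) ^ γ - (max b 0) ^ γ| ≤ γ * M ^ (γ - 1) * |a - b| := by
  have hderiv : ∀ x ∈ Icc (0 : ℝ) M,
      HasDerivWithinAt (fun x : ℝ => x ^ γ) (γ * x ^ (γ - 1)) (Icc 0 M) x := fun x _ =>
    (Real.hasDerivAt_rpow_const (Or.inr hγ)).hasDerivWithinAt
  have hbound : ∀ x ∈ Icc (0 : ℝ) M, ‖γ * x ^ (γ - 1)‖ ≤ γ * M ^ (γ - 1) := by
    intro x hx
    have hx0 := Real.rpow_nonneg hx.1 (γ - 1)
    rw [Real.norm_of_nonneg (by positivity)]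
    have := Real.rpow_le_rpow hx.1 hx.2 (by linarith : 0 ≤ γ - 1)
    gcongr
  have h := Convex.norm_image_sub_le_of_norm_hasDerivWithin_le hderiv hbound (convex_Icc 0 M)
    (⟨le_max_right b 0, max_le hb hM⟩ : max b 0 ∈ Icc (0 : ℝ) M)
    (⟨le_max_right a 0, max_le ha hM⟩ : max a 0 ∈ Icc (0 : ℝ) M)
  rw [Real.norm_eq_abs, Real.norm_eq_abs] at h
  refine h.trans ?_
  have := abs_max_sub_max_le_abs a b 0
  have := Real.rpow_nonneg hM (γ - 1)
  gcongr

lemma abs_log_le_two_mul {t : ℝ} (ht : 1 / 2 ≤ t) : |Real.log t| ≤ 2 * |t - 1| := by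
  have h0 : 0 < t := by linarith
  have h1 := Real.log_le_sub_one_of_pos h0
  have h2 := Real.one_sub_inv_le_log_of_pos h0
  have h3 : -(2 * |t - 1|) ≤ 1 - t⁻¹ := by
    have e : 1 - t⁻¹ = (t - 1) * t⁻¹ := by field_simp
    have hi : t⁻¹ ≤ 2 := by
      rw [inv_le_comm₀ h0 (by norm_num)]; linarith
    have hi0 : 0 < t⁻¹ := inv_pos.2 h0
    rw [e]
    nlinarith [neg_abs_le (t - 1), abs_nonneg (t - 1)]
  rw [abs_le]
  constructor
  · linarith
  · linarith [le_abs_self (t - 1), abs_nonneg (t - 1)]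

section Profile

variable {Γ : E2 → ℝ} {m : ℝ}

lemma neg_log_le_profile (hm : 0 < m) (hcont : Continuous Γ)
    (hpos : {x : E2 | 0 < Γ x} = ball (0 : E2) 1)
    (hlog : ∀ x : E2, 1 < ‖x‖ → Γ x = -m * Real.log ‖x‖)
    {R : ℝ} (hR : 1 ≤ R) {w : E2} (hw : ‖w‖ ≤ R) : -m * Real.log R ≤ Γ w := by
  rcases lt_or_ge 1 ‖w‖ with h | h
  · rw [hlog w h]
    have := Real.log_le_log (by linarith) hw
    nlinarith
  · have hsub : closure (ball (0 : E2) 1) ⊆ {x | 0 ≤ Γ x} := by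
      refine closure_minimal ?_ (isClosed_le continuous_const hcont)
      rw [← hpos]
      exact fun x (hx : 0 < Γ x) => hx.le
    rw [closure_ball _ one_ne_zero] at hsub
    have h0 : 0 ≤ Γ w := hsub (by simpa using h)
    have := Real.log_nonneg hR
    nlinarith

lemma profile_nonpos (hpos : {x : E2 | 0 < Γ x} = ball (0 : E2) 1) {w : E2} (hw : 1 ≤ ‖w‖) :
    Γ w ≤ 0 := by
  by_contra! h
  have : w ∈ ball (0 : E2) 1 := hpos ▸ h
  rw [mem_ball_zero_iff] at this
  linarith

lemma profile_bounded_above (hcont : Continuous Γ)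
    (hpos : {x : E2 | 0 < Γ x} = ball (0 : E2) 1) : ∃ M, 0 ≤ M ∧ ∀ w, Γ w ≤ M := by
  obtain ⟨M, hM⟩ := (isCompact_closedBall (0 : E2) 1).bddAbove_image hcont.continuousOn
  refine ⟨max M 0, le_max_right _ _, fun w => ?_⟩
  rcases le_total ‖w‖ 1 with h | h
  · exact (hM ⟨w, by simpa using h, rfl⟩).trans (le_max_left _ _)
  · exact (profile_nonpos hpos h).trans (le_max_right _ _)

/-- If the stream is positive at `z` and `-ε z₂ ≤ t`, then `‖z‖` is bounded independently
of `ε`. -/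
lemma norm_lt_of_vortexStream_pos (hm : 0 < m) (hcont : Continuous Γ)
    (hpos : {x : E2 | 0 < Γ x} = ball (0 : E2) 1)
    (hlog : ∀ x : E2, 1 < ‖x‖ → Γ x = -m * Real.log ‖x‖)
    {Q₀ s q k ε t : ℝ} (hQ₀ : 0 < Q₀) (hs : 0 < s) (hq : Q₀⁻¹ < q) (hε : 0 < ε)
    (hεq : ε ≤ 2 * q) (hk : 0 < k) (hkm : k ≤ m * Q₀) {z : E2} (hz : ‖z‖ < s / ε)
    (ht : 0 ≤ t) (hzt : -(ε * z 1) ≤ t) (hpz : 0 < vortexStream Γ m q k ε z) :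
    ‖z‖ ≤ (1 + s * Q₀ / 2) * Real.exp (Q₀ * t) := by
  have hq0 : 0 < q := (inv_pos.2 hQ₀).trans hq
  have hexp : 1 ≤ Real.exp (Q₀ * t) := Real.one_le_exp (by positivity)
  rcases le_or_gt ‖z‖ 1 with h1 | h1
  · have : 0 < s * Q₀ / 2 := by positivity
    nlinarith
  set D := 2 * q / ε with hD
  have hD1 : 1 ≤ D := by rw [hD, le_div_iff₀ hε]; linarith
  have hD0 : 0 < D := by linarith
  have hsum : ‖z + D • e2‖ ≤ ‖z‖ + D := by
    refine (norm_add_le _ _).trans ?_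
    rw [norm_smul, norm_e2, Real.norm_of_nonneg hD0.le, mul_one]
  have hlow := neg_log_le_profile hm hcont hpos hlog (by linarith : 1 ≤ ‖z‖ + D) hsum
  unfold vortexStream at hpz
  rw [← hD, hlog z h1] at hpz
  have hkt : -(k * ε * z 1) ≤ m * (Q₀ * t) := by
    have a1 : k * (-(ε * z 1)) ≤ k * t := mul_le_mul_of_nonneg_left hzt hk.le
    have a2 : k * t ≤ m * Q₀ * t := mul_le_mul_of_nonneg_right hkm ht
    linarith
  have hlogs : Real.log (‖z‖ * D) ≤ Real.log ((‖z‖ + D) * Real.exp (Q₀ * t)) := by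
    rw [Real.log_mul (by linarith) (by linarith), Real.log_mul (by linarith) (by positivity),
      Real.log_exp]
    have : 0 < m * (-Real.log ‖z‖ - Real.log D + Real.log (‖z‖ + D) + Q₀ * t) := by linarith
    have := pos_of_mul_pos_right this hm.le
    linarith
  have hle := (Real.log_le_log_iff (by positivity) (by positivity)).1 hlogs
  have hzD : ‖z‖ ≤ s * Q₀ / 2 * D := by
    have hQq : 1 ≤ Q₀ * q := by
      have := mul_le_mul_of_nonneg_left hq.le hQ₀.le
      rwa [mul_inv_cancel₀ hQ₀.ne'] at this
    have : s * Q₀ / 2 * D = s / ε * (Q₀ * q) := by rw [hD]; field_simp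
    rw [this]
    have : 0 < s / ε := by positivity
    nlinarith
  have hfin : ‖z‖ * D ≤ (1 + s * Q₀ / 2) * Real.exp (Q₀ * t) * D := by
    refine hle.trans ?_
    have : (‖z‖ + D) * Real.exp (Q₀ * t) ≤ (s * Q₀ / 2 * D + D) * Real.exp (Q₀ * t) := by gcongr
    linarith
  exact le_of_mul_le_mul_right hfin hD0

lemma abs_profile_sub_vortexStream_le (hm : 0 < m)
    (hlog : ∀ x : E2, 1 < ‖x‖ → Γ x = -m * Real.log ‖x‖)
    {Q₀ q k ε ρ : ℝ} (hQ₀ : 0 < Q₀) (hq : Q₀⁻¹ < q) (hε : 0 < ε) (hρ : 2 ≤ ρ)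
    (hεq : ε * ρ ≤ q) (hk : 0 < k) (hkm : k ≤ m * Q₀) {z : E2} (hz : ‖z‖ ≤ ρ) :
    |Γ z - vortexStream Γ m q k ε z| ≤ 2 * m * Q₀ * ρ * ε := by
  have hq0 : 0 < q := (inv_pos.2 hQ₀).trans hq
  have hqi : q⁻¹ ≤ Q₀ := inv_le_of_inv_le₀ hQ₀ hq.le
  set D := 2 * q / ε with hD
  have hDρ : 2 * ρ ≤ D := by rw [hD, le_div_iff₀ hε]; linarith
  have hD0 : 0 < D := by linarith
  have hDn : ‖D • e2‖ = D := by
    rw [norm_smul, norm_e2, Real.norm_of_nonneg hD0.le, mul_one]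
  have hdiff : |‖z + D • e2‖ - D| ≤ ρ := by
    have := abs_norm_sub_norm_le (z + D • e2) (D • e2)
    rw [hDn, add_sub_cancel_right] at this
    linarith
  have hlower : D - ρ ≤ ‖z + D • e2‖ := by linarith [(abs_le.1 hdiff).1]
  have hn : 1 < ‖z + D • e2‖ := by linarith
  have hlogd : |Real.log (‖z + D • e2‖ / D)| ≤ 2 * (ρ / D) := by
    have h2 : 1 / 2 ≤ ‖z + D • e2‖ / D := by rw [le_div_iff₀ hD0]; linarith
    refine (abs_log_le_two_mul h2).trans ?_
    have : ‖z + D • e2‖ / D - 1 = (‖z + D • e2‖ - D) / D := by field_simp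
    rw [this, abs_div, abs_of_pos hD0]
    gcongr
  have hrw : Γ z - vortexStream Γ m q k ε z
      = -(m * Real.log (‖z + D • e2‖ / D)) + k * ε * z 1 := by
    rw [vortexStream, ← hD, hlog _ hn, Real.log_div (by linarith) hD0.ne']
    ring
  rw [hrw]
  refine (abs_add_le _ _).trans ?_
  rw [abs_neg, abs_mul, abs_mul, abs_of_pos hm, abs_of_pos (mul_pos hk hε)]
  have h1 : m * |Real.log (‖z + D • e2‖ / D)| ≤ m * Q₀ * ρ * ε := by
    calc m * |Real.log (‖z + D • e2‖ / D)| ≤ m * (2 * (ρ / D)) := by gcongr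
      _ = m * q⁻¹ * ρ * ε := by rw [hD]; field_simp
      _ ≤ m * Q₀ * ρ * ε := by gcongr
  have h2 : k * ε * |z 1| ≤ m * Q₀ * ε * ρ := by
    have := (abs_apply_le_norm z 1).trans hz
    gcongr
  linarith

/-- For small `ε` the cut-off nonlinearity is supported in a ball of fixed radius in rescaled
coordinates, where it differs from `Γ₊ ^ γ` by `O(ε)`. -/
lemma exists_vortexStream_estimates (hm : 0 < m) (hcont : Continuous Γ)
    (hpos : {x : E2 | 0 < Γ x} = ball (0 : E2) 1)
    (hlog : ∀ x : E2, 1 < ‖x‖ → Γ x = -m * Real.log ‖x‖)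
    {γ Q₀ s q : ℝ} (hγ : 1 ≤ γ) (hQ₀ : 0 < Q₀) (hs : 0 < s) (hq : Q₀⁻¹ < q) :
    ∃ ε₀ > 0, ∃ C > 0, ∀ ε : ℝ, 0 < ε → ε ≤ ε₀ → ∀ k : ℝ, 0 < k → k ≤ m * Q₀ → ∀ z : E2,
      (‖z‖ < s / ε → 0 < vortexStream Γ m q k ε z →
        ‖z‖ < 2 * (1 + s * Q₀ / 2) * Real.exp (Q₀ ^ 2)) ∧
      (‖z‖ < 2 * (1 + s * Q₀ / 2) * Real.exp (Q₀ ^ 2) → ‖z‖ < s / ε ∧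
        |(max (Γ z) 0) ^ γ - (max (vortexStream Γ m q k ε z) 0) ^ γ| ≤ C * ε) := by
  have hq0 : 0 < q := (inv_pos.2 hQ₀).trans hq
  obtain ⟨M, hM0, hM⟩ := profile_bounded_above hcont hpos
  have hexp : 1 ≤ Real.exp (Q₀ ^ 2) := Real.one_le_exp (by positivity)
  set ρ := 2 * (1 + s * Q₀ / 2) * Real.exp (Q₀ ^ 2) with hρ
  have hsQ : 0 < s * Q₀ / 2 := by positivity
  have hρ2 : 2 ≤ ρ := by rw [hρ]; nlinarith
  have hρ0 : 0 < ρ := by linarith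
  set R := (1 + s * Q₀ / 2) * Real.exp (Q₀ * s) with hR
  have hR0 : 0 < R := by positivity
  set A := 2 * m * Q₀ * ρ with hA
  have hA0 : 0 < A := by positivity
  refine ⟨min (min 1 (q / ρ)) (min (Q₀ / R) (s / ρ)), by positivity,
    γ * (M + A) ^ (γ - 1) * A, by positivity, ?_⟩
  intro ε hε hle k hk hkm z
  obtain ⟨⟨hε1, hε2⟩, hε3, hε4⟩ : (ε ≤ 1 ∧ ε ≤ q / ρ) ∧ ε ≤ Q₀ / R ∧ ε ≤ s / ρ := by
    simpa only [le_min_iff] using hle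
  rw [le_div_iff₀ hρ0] at hε2 hε4
  rw [le_div_iff₀ hR0] at hε3
  have hz1 : -(ε * z 1) ≤ ε * ‖z‖ := by
    have := (neg_abs_le (z 1)).trans' (neg_le_neg (abs_apply_le_norm z 1))
    nlinarith
  refine ⟨fun hz hp => ?_, fun hz => ⟨?_, ?_⟩⟩
  · have hzs : ε * ‖z‖ ≤ s := by
      rw [lt_div_iff₀ hε] at hz; linarith
    have hεq : ε ≤ 2 * q := by nlinarith
    have h1 : ‖z‖ ≤ R := norm_lt_of_vortexStream_pos hm hcont hpos hlog hQ₀ hs hq hε hεq hk hkm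
      hz hs.le (hz1.trans hzs) hp
    have h2 : ε * ‖z‖ ≤ Q₀ := (mul_le_mul_of_nonneg_left h1 hε.le).trans hε3
    have h3 := norm_lt_of_vortexStream_pos hm hcont hpos hlog hQ₀ hs hq hε hεq hk hkm
      hz hQ₀.le (hz1.trans h2) hp
    rw [← sq] at h3
    linarith
  · rw [lt_div_iff₀ hε]
    nlinarith
  · have hd := abs_profile_sub_vortexStream_le hm hlog hQ₀ hq hε hρ2 hε2 hk hkm hz.le
    rw [← hA] at hd
    have hb : vortexStream Γ m q k ε z ≤ M + A := by
      have := (abs_le.1 hd).1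
      have := hM z
      nlinarith
    refine (abs_max_rpow_sub_le hγ (by linarith) ((hM z).trans (by linarith)) hb).trans ?_
    rw [mul_assoc _ A ε]
    gcongr

end Profile

lemma rescaled_stream_eq (Γ : E2 → ℝ) {m q k ε : ℝ} (hq : 0 < q) (hε : 0 < ε) (hε1 : ε < 1)
    (y : E2) :
    Γ (y - (q / ε) • e2) - Γ (y + (q / ε) • e2) - k * ε * y 1
        - |Real.log ε| * (m + (m * Real.log (2 * q) - k * q) / |Real.log ε|)
      = vortexStream Γ m q k ε (y - (q / ε) • e2) := by
  have hl : Real.log ε < 0 := Real.log_neg hε hε1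
  have hpt : y - (q / ε) • e2 + (2 * q / ε) • e2 = y + (q / ε) • e2 := by
    rw [mul_div_assoc, two_mul, add_smul]; abel
  have hy : (y - (q / ε) • e2) 1 = y 1 - q / ε := by simp [e2]
  have ha : |Real.log ε| ≠ 0 := abs_ne_zero.2 hl.ne
  rw [vortexStream, hpt, hy, Real.log_div (by positivity) hε.ne', mul_add,
    mul_div_cancel₀ _ ha, abs_of_neg hl]
  field_simp
  ring

/-- support of the nonlinearity: with `q∞ ∈ (Q₀⁻¹, Q₀)`, `0 < c(ε) ≤ mQ₀`
for small `ε`, and `Ω = m + (m log(2q∞) − c q∞)/|log ε|`, for all small `ε` the support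
of `f_ε(Ψ̊_ε − c x₂)` is contained in `B_{ρ₀ε}(q∞e₂) ∪ B_{ρ₀ε}(−q∞e₂)` with
`ρ₀ = 2(1 + sQ₀/2)e^{Q₀²}`, and in rescaled coordinates the nonlinearity is an `O(ε)`
perturbation of `(Γ(y ∓ q'e₂))₊^γ`, supported in `B_{ρ₀}(±q'e₂)`. -/
theorem statement_4 (γ m Q₀ s qinf : ℝ) (hγ : 3 < γ) (hm : 0 < m)
    (hQ₀ : 1 < Q₀) (hs : 0 < s) (hq : qinf ∈ Ioo Q₀⁻¹ Q₀)
    (Γ : E2 → ℝ)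
    (hΓ1 : ContDiff ℝ 1 Γ)
    (hΓrad : ∀ x y : E2, ‖x‖ = ‖y‖ → Γ x = Γ y)
    (hΓeq : ∀ x : E2, lap Γ x + (max (Γ x) 0) ^ γ = 0)
    (hΓpos : {x : E2 | 0 < Γ x} = ball (0 : E2) 1)
    (hΓlog : ∀ x : E2, 1 < ‖x‖ → Γ x = -m * Real.log ‖x‖)
    (c : ℝ → ℝ)
    (hc : ∃ ε₁ > 0, ∀ ε : ℝ, 0 < ε → ε < ε₁ → 0 < c ε ∧ c ε ≤ m * Q₀) :
    ∃ ε₀ > 0, ∃ C > 0, ∀ ε : ℝ, 0 < ε → ε ≤ ε₀ →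
      (∀ x : E2,
        fcut γ ε s qinf (c ε) (m + (m * Real.log (2 * qinf) - c ε * qinf) / |Real.log ε|)
          (fun z => Γ (ε⁻¹ • (z - qinf • e2)) - Γ (ε⁻¹ • (z + qinf • e2))) x ≠ 0 →
        x ∈ ball ((qinf • e2 : E2)) (2 * (1 + s * Q₀ / 2) * Real.exp (Q₀ ^ 2) * ε) ∪
            ball ((-(qinf • e2) : E2)) (2 * (1 + s * Q₀ / 2) * Real.exp (Q₀ ^ 2) * ε)) ∧
      (∀ y : E2,
        |(max (Γ (y - (qinf / ε) • e2)) 0) ^ γ -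
            Set.indicator (ball (((qinf / ε) • e2 : E2)) (s / ε))
              (fun z => (max (Γ (z - (qinf / ε) • e2) - Γ (z + (qinf / ε) • e2)
                  - c ε * ε * z 1 - |Real.log ε| *
                    (m + (m * Real.log (2 * qinf) - c ε * qinf) / |Real.log ε|)) 0) ^ γ) y|
          ≤ C * ε * Set.indicator (ball (((qinf / ε) • e2 : E2))
              (2 * (1 + s * Q₀ / 2) * Real.exp (Q₀ ^ 2))) (fun _ => (1:ℝ)) y) ∧
      (∀ y : E2,
        |(max (Γ (y + (qinf / ε) • e2)) 0) ^ γ -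
            Set.indicator (ball ((-((qinf / ε) • e2) : E2)) (s / ε))
              (fun z => (max (-(Γ (z - (qinf / ε) • e2) - Γ (z + (qinf / ε) • e2))
                  + c ε * ε * z 1 - |Real.log ε| *
                    (m + (m * Real.log (2 * qinf) - c ε * qinf) / |Real.log ε|)) 0) ^ γ) y|
          ≤ C * ε * Set.indicator (ball ((-((qinf / ε) • e2) : E2))
              (2 * (1 + s * Q₀ / 2) * Real.exp (Q₀ ^ 2))) (fun _ => (1:ℝ)) y) := by
  classical
  have hQ₀' : 0 < Q₀ := by linarith
  have hq0 : 0 < qinf := (inv_pos.2 hQ₀').trans hq.1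
  obtain ⟨ε₁, hε₁, hc⟩ := hc
  obtain ⟨ε₂, hε₂, C, hC, H⟩ := exists_vortexStream_estimates (γ := γ) (s := s) hm hΓ1.continuous
    hΓpos hΓlog (by linarith) hQ₀' hs hq.1
  refine ⟨min (min (ε₁ / 2) (1 / 2)) ε₂, by positivity, C, hC, ?_⟩
  intro ε hε hle
  obtain ⟨⟨h1, h2⟩, h3⟩ : (ε ≤ ε₁ / 2 ∧ ε ≤ 1 / 2) ∧ ε ≤ ε₂ := by
    simpa only [le_min_iff] using hle
  have hε1 : ε < 1 := by linarith
  obtain ⟨hk, hkm⟩ := hc ε hε (by linarith)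
  have H := H ε hε h3 (c ε) hk hkm
  set k := c ε
  set Ω := m + (m * Real.log (2 * qinf) - k * qinf) / |Real.log ε|
  set ρ := 2 * (1 + s * Q₀ / 2) * Real.exp (Q₀ ^ 2) with hρ
  have hρ1 : 1 ≤ ρ := by
    have : 1 ≤ Real.exp (Q₀ ^ 2) := Real.one_le_exp (by positivity)
    have : 0 < s * Q₀ / 2 := by positivity
    rw [hρ]; nlinarith
  have hγ0 : γ ≠ 0 := by linarith
  have heven : ∀ x, Γ (-x) = Γ x := fun x => hΓrad _ _ (norm_neg x)
  have hstream : ∀ y : E2, Γ (y - (qinf / ε) • e2) - Γ (y + (qinf / ε) • e2) - k * ε * y 1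
      - |Real.log ε| * Ω = vortexStream Γ m qinf k ε (y - (qinf / ε) • e2) :=
    rescaled_stream_eq Γ hq0 hε hε1
  have hsupp : ∀ y : E2, Set.indicator (ball (((qinf / ε) • e2 : E2)) (s / ε))
      (fun z => (max (Γ (z - (qinf / ε) • e2) - Γ (z + (qinf / ε) • e2) - k * ε * z 1
        - |Real.log ε| * Ω) 0) ^ γ) y ≠ 0 → y ∈ ball (((qinf / ε) • e2 : E2)) ρ := by
    intro y hy
    rw [Set.indicator_apply_ne_zero] at hy
    obtain ⟨hyb, hy⟩ := hy
    rw [Function.mem_support, hstream] at hy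
    rw [mem_ball, dist_eq_norm] at hyb ⊢
    refine (H _).1 hyb ?_
    by_contra! hneg
    rw [max_eq_right hneg, Real.zero_rpow hγ0] at hy
    exact hy rfl
  have hest : ∀ y : E2, |(max (Γ (y - (qinf / ε) • e2)) 0) ^ γ -
      Set.indicator (ball (((qinf / ε) • e2 : E2)) (s / ε))
        (fun z => (max (Γ (z - (qinf / ε) • e2) - Γ (z + (qinf / ε) • e2) - k * ε * z 1
          - |Real.log ε| * Ω) 0) ^ γ) y|
      ≤ C * ε * Set.indicator (ball (((qinf / ε) • e2 : E2)) ρ) (fun _ => (1 : ℝ)) y := by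
    intro y
    by_cases hy : y ∈ ball (((qinf / ε) • e2 : E2)) ρ
    · have hn := hy
      rw [mem_ball, dist_eq_norm] at hn
      obtain ⟨hns, hb⟩ := (H _).2 hn
      rw [Set.indicator_of_mem hy, Set.indicator_of_mem (by rwa [mem_ball, dist_eq_norm]),
        hstream, mul_one]
      exact hb
    · have h0 := not_imp_comm.1 (hsupp y) hy
      rw [h0, Set.indicator_of_notMem hy]
      rw [mem_ball, dist_eq_norm, not_lt] at hy
      rw [max_eq_right (profile_nonpos hΓpos (hρ1.trans hy)), Real.zero_rpow hγ0]
      simp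
  have hmem : ∀ (p x : E2) (r : ℝ), -x ∈ ball p r ↔ x ∈ ball (-p) r := by
    intro p x r
    rw [mem_ball, mem_ball, ← dist_neg_neg, neg_neg]
  have hreflect : ∀ y : E2, Set.indicator (ball ((-((qinf / ε) • e2) : E2)) (s / ε))
      (fun z => (max (-(Γ (z - (qinf / ε) • e2) - Γ (z + (qinf / ε) • e2)) + k * ε * z 1
        - |Real.log ε| * Ω) 0) ^ γ) y
      = Set.indicator (ball (((qinf / ε) • e2 : E2)) (s / ε))
      (fun z => (max (Γ (z - (qinf / ε) • e2) - Γ (z + (qinf / ε) • e2) - k * ε * z 1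
        - |Real.log ε| * Ω) 0) ^ γ) (-y) := by
    intro y
    have ha : Γ (-y - (qinf / ε) • e2) = Γ (y + (qinf / ε) • e2) := by
      rw [← heven, neg_sub, sub_neg_eq_add, add_comm]
    have hb : Γ (-y + (qinf / ε) • e2) = Γ (y - (qinf / ε) • e2) := by
      rw [← heven, neg_add, neg_neg, sub_eq_add_neg]
    rw [Set.indicator_apply, Set.indicator_apply, ha, hb, PiLp.neg_apply]
    simp only [hmem]
    congr 3
    ring
  refine ⟨?_, hest, ?_⟩
  · intro x hx
    have hscale : ∀ (p : E2) (r : ℝ), ε⁻¹ • x ∈ ball ((1 / ε) • p) (r / ε) ↔ x ∈ ball p r := by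
      intro p r
      rw [mem_ball, mem_ball, dist_eq_norm, dist_eq_norm, one_div, ← smul_sub, norm_smul,
        norm_inv, Real.norm_of_nonneg hε.le, inv_mul_eq_div, div_lt_div_iff_of_pos_right hε]
    have hpe : (qinf / ε) • e2 = (1 / ε) • (qinf • e2) := by
      rw [smul_smul]; congr 1; ring
    have hm1 : ε⁻¹ • (x - qinf • e2) = ε⁻¹ • x - (qinf / ε) • e2 := by
      rw [hpe, smul_sub, one_div]
    have hm2 : ε⁻¹ • (x + qinf • e2) = ε⁻¹ • x + (qinf / ε) • e2 := by
      rw [hpe, smul_add, one_div]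
    have hk1 : k * ε * (ε⁻¹ • x) 1 = k * x 1 := by
      rw [PiLp.smul_apply, smul_eq_mul]; field_simp
    have hf : fcut γ ε s qinf k Ω
        (fun z => Γ (ε⁻¹ • (z - qinf • e2)) - Γ (ε⁻¹ • (z + qinf • e2))) x
        = Set.indicator (ball (((qinf / ε) • e2 : E2)) (s / ε))
            (fun z => (max (Γ (z - (qinf / ε) • e2) - Γ (z + (qinf / ε) • e2) - k * ε * z 1
              - |Real.log ε| * Ω) 0) ^ γ) (ε⁻¹ • x)
          - Set.indicator (ball ((-((qinf / ε) • e2) : E2)) (s / ε))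
            (fun z => (max (-(Γ (z - (qinf / ε) • e2) - Γ (z + (qinf / ε) • e2)) + k * ε * z 1
              - |Real.log ε| * Ω) 0) ^ γ) (ε⁻¹ • x) := by
      have hpe' : -((qinf / ε) • e2) = (1 / ε) • (-(qinf • e2)) := by rw [hpe, smul_neg]
      simp only [fcut, Set.indicator_apply, hk1, hm1, hm2, hpe', ← hscale]
      rw [hpe]
    rw [hf, hreflect] at hx
    have hρε : ρ = ρ * ε / ε := by field_simp
    by_cases hA : Set.indicator (ball (((qinf / ε) • e2 : E2)) (s / ε))
            (fun z => (max (Γ (z - (qinf / ε) • e2) - Γ (z + (qinf / ε) • e2) - k * ε * z 1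
              - |Real.log ε| * Ω) 0) ^ γ) (ε⁻¹ • x) = 0
    · rw [hA, zero_sub, neg_ne_zero] at hx
      have := hsupp _ hx
      rw [hmem, hpe, ← smul_neg, hρε, hscale] at this
      exact Or.inr this
    · have := hsupp _ hA
      rw [hpe, hρε, hscale] at this
      exact Or.inl this
  · intro y
    have h := hest (-y)
    rw [← hreflect, ← heven (-y - _), neg_sub, sub_neg_eq_add, add_comm _ y] at h
    refine h.trans_eq ?_
    simp only [Set.indicator_apply, hmem]
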